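/- arXiv:1001.4674 — 3 statements merged into one kernel-verified Lean document; each statement's English description precedes it below -/
import Mathlib

section
/- Key numerical inequality in the proof of the generalized Harris lemma: Let k ≥ 0 and let C be a positive integer. Let p_0, p_1, …, p_k and a_0, …, a_k and b_0, …, b_k be nonnegative real numbers such that Σ_{i=0}^k p_i = 1, p_0·C ≥ 2, a_0 = max_{0≤i≤k} a_i, and b_0 = max_{0≤i≤k} b_i. Set a = Σ_{i=0}^k p_i a_i and b = Σ_{i=0}^k p_i b_i. Then Σ_{i=0}^k p_i (a_i b_i)^C ≥ (a·b)^C. -/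
/-- A Bernoulli-type comparison of powers of two affine functions. -/
theorem one_sub_pow_le_one_sub_half_mul_pow (n : ℕ) {q w : ℝ}
    (hqn : q * (2 * n + 1) ≤ 2 * n) (hw0 : 0 ≤ w) (hw1 : w ≤ 1) :
    (1 - w) ^ n ≤ (1 - q * w / 2) ^ (2 * n + 1) := by
  have hn : (0 : ℝ) < 2 * n + 1 := by positivity
  set r : ℝ := n / (2 * n + 1) with hr
  have hr0 : 0 ≤ r := by positivity
  have hr1 : r ≤ 1 := by
    rw [hr, div_le_one hn]
    linarith [(Nat.cast_nonneg n : (0 : ℝ) ≤ n)]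
  have hqr : q / 2 ≤ r := by
    rw [hr, div_le_div_iff₀ two_pos hn]
    linarith
  have hbern : (1 - w) ^ r ≤ 1 - q * w / 2 := by
    have h := rpow_one_add_le_one_add_mul_self (s := -w) (by linarith) hr0 hr1
    rw [← sub_eq_add_neg] at h
    nlinarith
  have hpow : ((1 - w) ^ r) ^ (2 * n + 1) = (1 - w) ^ n := by
    have hrn : r * ((2 * n + 1 : ℕ) : ℝ) = n := by
      push_cast
      rw [hr, div_mul_cancel₀ _ hn.ne']
    rw [← Real.rpow_natCast, ← Real.rpow_mul (by linarith), hrn, Real.rpow_natCast]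
  rw [← hpow]
  exact pow_le_pow_left₀ (Real.rpow_nonneg (by linarith) r) hbern _

/-- The two-point case, in which the mass `q` sits at `1 - w` and the rest at `1`. -/
theorem one_sub_half_mul_pow_le (n : ℕ) {q w : ℝ} (hq : 0 ≤ q)
    (hqn : q * (2 * n + 1) ≤ 2 * n) (hw0 : 0 ≤ w) (hw1 : w ≤ 1) :
    (1 - q * w / 2) ^ (2 * n + 2) ≤ 1 - q + q * (1 - w) ^ (n + 1) := by
  let f : ℝ → ℝ := fun x ↦ 1 - q + q * (1 - x) ^ (n + 1) - (1 - q * x / 2) ^ (2 * n + 2)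
  let f' : ℝ → ℝ := fun x ↦ q * (n + 1) * ((1 - q * x / 2) ^ (2 * n + 1) - (1 - x) ^ n)
  have hderiv (x : ℝ) : HasDerivAt f (f' x) x := by
    have h1 := ((((hasDerivAt_id x).const_sub 1).pow (n + 1)).const_mul q).const_add (1 - q)
    have h2 := ((((hasDerivAt_id x).const_mul q).div_const 2).const_sub 1).pow (2 * n + 2)
    refine (h1.sub h2).congr_deriv ?_
    simp only [f', id, Nat.add_sub_cancel, show 2 * n + 2 - 1 = 2 * n + 1 from rfl]
    push_cast
    ring
  have hmono : MonotoneOn f (Set.Icc 0 1) := by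
    refine monotoneOn_of_hasDerivWithinAt_nonneg (convex_Icc 0 1)
      (fun x _ ↦ (hderiv x).continuousAt.continuousWithinAt)
      (fun x _ ↦ (hderiv x).hasDerivWithinAt) fun x hx ↦ ?_
    rw [interior_Icc] at hx
    exact mul_nonneg (by positivity)
      (sub_nonneg.2 (one_sub_pow_le_one_sub_half_mul_pow n hqn hx.1.le hx.2.le))
  have h := hmono (Set.left_mem_Icc.2 zero_le_one) ⟨hw0, hw1⟩ hw0
  simp only [f, mul_zero, zero_div, sub_zero, one_pow, mul_one, sub_add_cancel, sub_self] at h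
  linarith

/-- A strengthening of Jensen's inequality for powers when one of the values is `1`. -/
theorem one_sub_half_sum_pow_le {k : ℕ} (n : ℕ) {p w : Fin (k + 1) → ℝ}
    (hp : ∀ i, 0 ≤ p i) (hsum : ∑ i, p i = 1) (hpn : (1 - p 0) * (2 * n + 1) ≤ 2 * n)
    (hw : ∀ i, 0 ≤ w i) (hw1 : ∀ i, w i ≤ 1) (hw0 : w 0 = 0) :
    (1 - (∑ i, p i * w i) / 2) ^ (2 * n + 2) ≤ ∑ i, p i * (1 - w i) ^ (n + 1) := by
  have hq : ∑ i : Fin k, p i.succ = 1 - p 0 := by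
    rw [Fin.sum_univ_succ] at hsum
    linarith
  have hq0 : 0 ≤ 1 - p 0 := hq ▸ Finset.sum_nonneg fun i _ ↦ hp _
  rw [Fin.sum_univ_succ, Fin.sum_univ_succ, hw0]
  simp only [mul_zero, zero_add, sub_zero, one_pow, mul_one]
  rcases hq0.eq_or_lt with h0 | hpos
  · have hz (i : Fin k) : p i.succ = 0 :=
      (Finset.sum_eq_zero_iff_of_nonneg fun i _ ↦ hp (Fin.succ i)).1 (hq.trans h0.symm) i
        (Finset.mem_univ i)
    simp only [hz, zero_mul, Finset.sum_const_zero, zero_div, sub_zero, one_pow, add_zero]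
    linarith
  set q := 1 - p 0 with hqdef
  set W := ∑ i : Fin k, p i.succ * w i.succ with hW
  have hW0 : 0 ≤ W := Finset.sum_nonneg fun i _ ↦ mul_nonneg (hp _) (hw _)
  have hWq : W ≤ q := hq ▸ Finset.sum_le_sum fun i _ ↦ mul_le_of_le_one_right (hp _) (hw1 _)
  have hjensen := Real.pow_arith_mean_le_arith_mean_pow Finset.univ
    (fun i : Fin k ↦ p i.succ / q) (fun i ↦ 1 - w i.succ)
    (fun i _ ↦ div_nonneg (hp _) hq0)
    (by rw [← Finset.sum_div, hq, div_self hpos.ne'])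
    (fun i _ ↦ sub_nonneg.2 (hw1 _)) (n + 1)
  have hmean : ∑ i : Fin k, p i.succ / q * (1 - w i.succ) = 1 - W / q := by
    simp only [mul_sub, mul_one, Finset.sum_sub_distrib, div_mul_eq_mul_div]
    rw [← Finset.sum_div, ← Finset.sum_div, hq, div_self hpos.ne']
  have htwo := one_sub_half_mul_pow_le n hq0 hpn (div_nonneg hW0 hq0) ((div_le_one hpos).2 hWq)
  rw [mul_div_cancel₀ _ hpos.ne'] at htwo
  rw [hmean] at hjensen
  simp only [div_mul_eq_mul_div] at hjensen
  rw [← Finset.sum_div, le_div_iff₀' hpos] at hjensen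
  linarith

/-- The inequality for values in `[0, 1]` whose maximum `1` is attained at `0`. -/
theorem mul_weighted_sums_pow_le_of_le_one {k : ℕ} (n : ℕ) {p a b : Fin (k + 1) → ℝ}
    (hp : ∀ i, 0 ≤ p i) (hsum : ∑ i, p i = 1) (hpn : (1 - p 0) * (2 * n + 1) ≤ 2 * n)
    (ha : ∀ i, 0 ≤ a i) (hb : ∀ i, 0 ≤ b i) (ha1 : ∀ i, a i ≤ 1) (hb1 : ∀ i, b i ≤ 1)
    (ha0 : a 0 = 1) (hb0 : b 0 = 1) :
    ((∑ i, p i * a i) * ∑ i, p i * b i) ^ (n + 1) ≤ ∑ i, p i * (a i * b i) ^ (n + 1) := by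
  let w : Fin (k + 1) → ℝ := fun i ↦ min 1 (2 - a i - b i)
  have hw (i) : 0 ≤ w i := le_min zero_le_one (by linarith [ha1 i, hb1 i])
  have hw1 (i) : w i ≤ 1 := min_le_left _ _
  have hw0 : w 0 = 0 := by norm_num [w, ha0, hb0]
  have hA : 0 ≤ ∑ i, p i * a i := Finset.sum_nonneg fun i _ ↦ mul_nonneg (hp i) (ha i)
  have hB : 0 ≤ ∑ i, p i * b i := Finset.sum_nonneg fun i _ ↦ mul_nonneg (hp i) (hb i)
  have hW : ∑ i, p i * w i ≤ 2 - ∑ i, p i * a i - ∑ i, p i * b i := by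
    calc ∑ i, p i * w i ≤ ∑ i, p i * (2 - a i - b i) :=
          Finset.sum_le_sum fun i _ ↦ mul_le_mul_of_nonneg_left (min_le_right _ _) (hp i)
      _ = 2 - ∑ i, p i * a i - ∑ i, p i * b i := by
          simp only [mul_sub, Finset.sum_sub_distrib]
          rw [← Finset.sum_mul, hsum, one_mul]
  have hAB : (∑ i, p i * a i) * ∑ i, p i * b i ≤ (1 - (∑ i, p i * w i) / 2) ^ 2 := by
    nlinarith [sq_nonneg (∑ i, p i * a i - ∑ i, p i * b i)]
  calc ((∑ i, p i * a i) * ∑ i, p i * b i) ^ (n + 1)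
      ≤ ((1 - (∑ i, p i * w i) / 2) ^ 2) ^ (n + 1) :=
        pow_le_pow_left₀ (mul_nonneg hA hB) hAB _
    _ = (1 - (∑ i, p i * w i) / 2) ^ (2 * n + 2) := by rw [← pow_mul, mul_add, mul_one]
    _ ≤ ∑ i, p i * (1 - w i) ^ (n + 1) := one_sub_half_sum_pow_le n hp hsum hpn hw hw1 hw0
    _ ≤ ∑ i, p i * (a i * b i) ^ (n + 1) := by
        refine Finset.sum_le_sum fun i _ ↦ mul_le_mul_of_nonneg_left
          (pow_le_pow_left₀ (sub_nonneg.2 (hw1 i)) ?_ _) (hp i)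
        have hab : 1 - a i * b i ≤ w i :=
          le_min (by linarith [mul_nonneg (ha i) (hb i)])
            (by nlinarith [mul_nonneg (sub_nonneg.2 (ha1 i)) (sub_nonneg.2 (hb1 i))])
        linarith


/-- **Key numerical inequality** in the proof of the generalized Harris lemma:
if `p₀,…,p_k` are nonnegative reals summing to `1` with `p₀·C ≥ 2`, and
`a_i`, `b_i` are nonnegative reals maximized at `i = 0`, then
`∑ p_i (a_i b_i)^C ≥ ((∑ p_i a_i)(∑ p_i b_i))^C`. -/
theorem harris_key_numerical_inequality (k : ℕ) (C : ℕ) (hC : 0 < C)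
    (p a b : Fin (k + 1) → ℝ)
    (hp : ∀ i, 0 ≤ p i) (ha : ∀ i, 0 ≤ a i) (hb : ∀ i, 0 ≤ b i)
    (hsum : ∑ i, p i = 1)
    (hpC : 2 ≤ p 0 * (C : ℝ))
    (ha0 : ∀ i, a i ≤ a 0) (hb0 : ∀ i, b i ≤ b 0) :
    (∑ i, p i * (a i * b i) ^ C) ≥ ((∑ i, p i * a i) * (∑ i, p i * b i)) ^ C := by
  obtain ⟨n, rfl⟩ := Nat.exists_eq_add_of_lt hC
  rw [zero_add] at hpC ⊢
  rcases (ha 0).eq_or_lt with hA | hA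
  · have hz (i) : a i = 0 := le_antisymm (hA ▸ ha0 i) (ha i)
    simp [hz]
  rcases (hb 0).eq_or_lt with hB | hB
  · have hz (i) : b i = 0 := le_antisymm (hB ▸ hb0 i) (hb i)
    simp [hz]
  have hp1 : p 0 ≤ 1 := hsum ▸ Finset.single_le_sum (fun i _ ↦ hp i) (Finset.mem_univ 0)
  have hpn : (1 - p 0) * (2 * n + 1) ≤ 2 * n := by
    push_cast at hpC
    linarith
  have h := mul_weighted_sums_pow_le_of_le_one n (a := fun i ↦ a i / a 0)
    (b := fun i ↦ b i / b 0) hp hsum hpn (fun i ↦ div_nonneg (ha i) hA.le)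
    (fun i ↦ div_nonneg (hb i) hB.le) (fun i ↦ (div_le_one hA).2 (ha0 i))
    (fun i ↦ (div_le_one hB).2 (hb0 i)) (div_self hA.ne') (div_self hB.ne')
  simp only [div_mul_div_comm, div_pow] at h
  simp only [← mul_div_assoc, ← Finset.sum_div] at h
  rw [div_mul_eq_mul_div, div_div, div_pow] at h
  exact (div_le_div_iff_of_pos_right (pow_pos (mul_pos hA hB) _)).1 h
end

section
/- Abstract form of the generalized Harris lemma (Lemma 3.2): Let P be a finite poset with a greatest element x_0, and let μ be a probability measure on P with μ(x_0) > 0. Then there exists a function F : (0,1] × (0,1] → (0,1], strictly increasing in each argument, such that for every n ≥ 1 and any two upsets A and B in P^n with μ^n(A) > 0 and μ^n(B) > 0, one has μ^n(A ∩ B) ≥ F(μ^n(A), μ^n(B)). -/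
/-- The truncation of the binomial expansion after the quadratic term is a lower bound. -/
theorem one_add_quadratic_le_pow {z : ℝ} (hz : 0 ≤ z) (n : ℕ) :
    1 + n * z + n * (n - 1) / 2 * z ^ 2 ≤ (1 + z) ^ n := by
  induction n with
  | zero => simp
  | succ k ih =>
    have hk : (0 : ℝ) ≤ k * (k - 1) / 2 := by
      rcases k with _ | k
      · simp
      · push_cast
        have : (0 : ℝ) ≤ k := k.cast_nonneg
        have : (k : ℝ) + 1 - 1 = k := by ring
        rw [this]
        positivity
    have h := mul_le_mul_of_nonneg_right ih (by linarith : 0 ≤ 1 + z)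
    have h3 : 0 ≤ (k * (k - 1) / 2 : ℝ) * z ^ 3 := by positivity
    rw [pow_succ (1 + z)]
    push_cast
    linarith

/-- A reverse Chebyshev inequality: if two nonnegative functions attain their maxima at a common
atom `x0`, then `(E f · E g) ^ C ≤ E[(f g) ^ C]` for every large enough exponent `C`. -/
theorem pow_expectation_mul_le {P : Type*} [Fintype P] {μ : P → ℝ} (hμ0 : ∀ x, 0 ≤ μ x)
    (hμ1 : ∑ x, μ x = 1) {x0 : P} {C : ℕ} (hC0 : C ≠ 0) (hC : 2 ≤ μ x0 * (C - 1))
    {f g : P → ℝ} (hf : ∀ x, 0 ≤ f x) (hg : ∀ x, 0 ≤ g x)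
    (hf0 : ∀ x, f x ≤ f x0) (hg0 : ∀ x, g x ≤ g x0) :
    ((∑ x, μ x * f x) * ∑ x, μ x * g x) ^ C ≤ ∑ x, μ x * (f x * g x) ^ C := by
  classical
  set S := ∑ x, μ x * f x with hS
  set T := ∑ x, μ x * g x with hT
  have hS0 : 0 ≤ S := Finset.sum_nonneg fun x _ => mul_nonneg (hμ0 x) (hf x)
  have hT0 : 0 ≤ T := Finset.sum_nonneg fun x _ => mul_nonneg (hμ0 x) (hg x)
  rcases (mul_nonneg hS0 hT0).eq_or_lt with hR | hR
  · rw [← hR, zero_pow hC0]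
    exact Finset.sum_nonneg fun x _ => mul_nonneg (hμ0 x) (pow_nonneg (mul_nonneg (hf x) (hg x)) _)
  have hSa : S ≤ f x0 := by
    calc S ≤ ∑ x, μ x * f x0 :=
          Finset.sum_le_sum fun x _ => mul_le_mul_of_nonneg_left (hf0 x) (hμ0 x)
      _ = f x0 := by rw [← Finset.sum_mul, hμ1, one_mul]
  have hTb : T ≤ g x0 := by
    calc T ≤ ∑ x, μ x * g x0 :=
          Finset.sum_le_sum fun x _ => mul_le_mul_of_nonneg_left (hg0 x) (hμ0 x)
      _ = g x0 := by rw [← Finset.sum_mul, hμ1, one_mul]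
  set a := f x0
  set b := g x0
  set R := S * T
  set E := ∑ x, μ x * (f x * g x) with hE
  have hcov : R - E ≤ (a - S) * (b - T) := by
    have h : 0 ≤ ∑ x, μ x * ((a - f x) * (b - g x)) := Finset.sum_nonneg fun x _ =>
      mul_nonneg (hμ0 x) (mul_nonneg (sub_nonneg.2 (hf0 x)) (sub_nonneg.2 (hg0 x)))
    have h' : ∑ x, μ x * ((a - f x) * (b - g x)) = a * b - a * T - b * S + E := by
      have : ∀ x, μ x * ((a - f x) * (b - g x)) =
          μ x * (a * b) - a * (μ x * g x) - b * (μ x * f x) + μ x * (f x * g x) :=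
        fun x => by ring
      simp only [this, Finset.sum_add_distrib, Finset.sum_sub_distrib, ← Finset.mul_sum,
        ← Finset.sum_mul, hμ1, one_mul, hS, hT, hE]
    have hRST : R = S * T := rfl
    nlinarith
  have hgap : R * ((a - S) * (b - T)) ≤ (a * b - R) ^ 2 := by
    have h1 : S * (b - T) ≤ a * b - R := by
      have : 0 ≤ (a - S) * b := mul_nonneg (by linarith) (hg x0)
      change _ ≤ a * b - S * T
      linarith
    have h2 : T * (a - S) ≤ a * b - R := by
      have : 0 ≤ (b - T) * a := mul_nonneg (by linarith) (hf x0)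
      change _ ≤ a * b - S * T
      linarith
    have h := mul_le_mul h1 h2 (mul_nonneg hT0 (by linarith))
      ((mul_nonneg hS0 (by linarith)).trans h1)
    calc R * ((a - S) * (b - T)) = S * (b - T) * (T * (a - S)) := by
          change S * T * _ = _
          ring
      _ ≤ (a * b - R) ^ 2 := by rw [sq]; exact h
  have hRab : R ≤ a * b := mul_le_mul hSa hTb hT0 (hf x0)
  set z := a * b / R - 1 with hz
  have hz0 : 0 ≤ z := by rw [hz, sub_nonneg, le_div_iff₀ hR]; linarith
  have hzR : z * R = a * b - R := by rw [hz]; field_simp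
  have hdef : 1 - E / R ≤ z ^ 2 := by
    have h : R * (R - E) ≤ (z * R) ^ 2 := by
      rw [hzR]; exact (mul_le_mul_of_nonneg_left hcov hR.le).trans hgap
    have h2 : (1 - E / R) * R ^ 2 ≤ z ^ 2 * R ^ 2 := by
      calc (1 - E / R) * R ^ 2 = R * (R - E) := by field_simp
        _ ≤ _ := by rw [← mul_pow]; exact h
    exact le_of_mul_le_mul_right h2 (by positivity)
  have hpt : ∀ x, μ x * (1 + C * (f x * g x / R - 1)) +
      (if x = x0 then μ x0 * (C * (C - 1) / 2 * z ^ 2) else 0) ≤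
      μ x * (f x * g x / R) ^ C := by
    intro x
    split_ifs with h
    · subst h
      rw [← mul_add]
      refine mul_le_mul_of_nonneg_left ?_ (hμ0 x)
      have h := one_add_quadratic_le_pow hz0 C
      rwa [show 1 + z = f x * g x / R by rw [hz]; ring] at h
    · rw [add_zero]
      refine mul_le_mul_of_nonneg_left ?_ (hμ0 x)
      have hnn : 0 ≤ f x * g x / R := div_nonneg (mul_nonneg (hf x) (hg x)) hR.le
      have h := one_add_mul_le_pow (a := f x * g x / R - 1) (by linarith) C
      rwa [add_sub_cancel] at h
  have hsum := Finset.sum_le_sum fun x (_ : x ∈ Finset.univ) => hpt x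
  have hlin : ∑ x, μ x * (1 + C * (f x * g x / R - 1)) = 1 - C * (1 - E / R) := by
    have : ∀ x, μ x * (1 + C * (f x * g x / R - 1)) =
        μ x - C * (μ x - μ x * (f x * g x) / R) := fun x => by ring
    simp only [this, Finset.sum_sub_distrib, ← Finset.mul_sum, ← Finset.sum_div, hμ1, hE]
  have hpow : ∑ x, μ x * (f x * g x / R) ^ C = (∑ x, μ x * (f x * g x) ^ C) / R ^ C := by
    rw [Finset.sum_div]
    exact Finset.sum_congr rfl fun x _ => by rw [div_pow, mul_div_assoc]
  rw [Finset.sum_add_distrib, hlin, Finset.sum_ite_eq' Finset.univ x0, if_pos (Finset.mem_univ _),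
    hpow] at hsum
  have hone : 1 ≤ (∑ x, μ x * (f x * g x) ^ C) / R ^ C := by
    refine le_trans ?_ hsum
    have h1 : (C : ℝ) * (1 - E / R) ≤ C * z ^ 2 :=
      mul_le_mul_of_nonneg_left hdef C.cast_nonneg
    have h2 : 2 * (C * z ^ 2) ≤ μ x0 * (C - 1) * (C * z ^ 2) :=
      mul_le_mul_of_nonneg_right hC (by positivity)
    linarith
  rwa [le_div_iff₀ (by positivity), one_mul] at hone

/-- Slicing the product measure of a set along the first coordinate. -/
theorem sum_indicator_prod_cons {P : Type*} [Fintype P] (μ : P → ℝ) {n : ℕ}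
    (A : Set (Fin (n + 1) → P)) :
    ∑ x, A.indicator (fun y => ∏ i, μ (y i)) x =
      ∑ p, μ p * ∑ x : Fin n → P,
        {y | (Fin.cons p y : Fin (n + 1) → P) ∈ A}.indicator (fun y => ∏ i, μ (y i)) x := by
  classical
  rw [← (Fin.consEquiv fun _ : Fin (n + 1) => P).sum_comp, Fintype.sum_prod_type]
  refine Finset.sum_congr rfl fun p _ => ?_
  rw [Finset.mul_sum]
  refine Finset.sum_congr rfl fun x _ => ?_
  simp [Set.indicator_apply, Fin.consEquiv, Fin.prod_univ_succ]

/-- Power form of the generalized Harris inequality for upsets in a product poset. -/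
theorem pow_mul_le_sum_indicator_inter {P : Type*} [Fintype P] [PartialOrder P] {x0 : P}
    (hx0 : ∀ x, x ≤ x0) {μ : P → ℝ} (hμ0 : ∀ x, 0 ≤ μ x) (hμ1 : ∑ x, μ x = 1)
    {C : ℕ} (hC0 : C ≠ 0) (hC : 2 ≤ μ x0 * (C - 1)) (n : ℕ) (A B : Set (Fin n → P))
    (hA : IsUpperSet A) (hB : IsUpperSet B) :
    ((∑ x, A.indicator (fun y => ∏ i, μ (y i)) x) *
        ∑ x, B.indicator (fun y => ∏ i, μ (y i)) x) ^ C ≤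
      ∑ x, (A ∩ B).indicator (fun y => ∏ i, μ (y i)) x := by
  classical
  induction n with
  | zero =>
    by_cases h1 : default ∈ A <;> by_cases h2 : default ∈ B <;>
      simp [Fintype.sum_unique, -Finset.univ_unique, -Finset.sum_boole, Set.indicator_apply, h1, h2, hC0]
  | succ n ih =>
    have hprod : ∀ y : Fin n → P, 0 ≤ ∏ i, μ (y i) := fun y => Finset.prod_nonneg fun i _ => hμ0 _
    have hslice : ∀ {D : Set (Fin (n + 1) → P)}, IsUpperSet D → ∀ p,
        IsUpperSet {y : Fin n → P | (Fin.cons p y : Fin (n + 1) → P) ∈ D} :=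
      fun hD p y z hyz hy => hD (Fin.cons_le_cons.2 ⟨le_rfl, hyz⟩) hy
    have hmax : ∀ {D : Set (Fin (n + 1) → P)}, IsUpperSet D → ∀ p,
        ∑ x : Fin n → P, {y | (Fin.cons p y : Fin (n + 1) → P) ∈ D}.indicator
          (fun y => ∏ i, μ (y i)) x ≤
        ∑ x : Fin n → P, {y | (Fin.cons x0 y : Fin (n + 1) → P) ∈ D}.indicator
          (fun y => ∏ i, μ (y i)) x :=
      fun hD p => Finset.sum_le_sum fun x _ => Set.indicator_le_indicator_apply_of_subset
        (fun y hy => hD (Fin.cons_le_cons.2 ⟨hx0 p, le_rfl⟩) hy) (hprod _)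
    have hnonneg : ∀ D : Set (Fin n → P), 0 ≤ ∑ x, D.indicator (fun y => ∏ i, μ (y i)) x :=
      fun D => Finset.sum_nonneg fun x _ => Set.indicator_nonneg (fun y _ => hprod y) x
    simp only [sum_indicator_prod_cons]
    refine (pow_expectation_mul_le hμ0 hμ1 hC0 hC (fun _ => hnonneg _) (fun _ => hnonneg _)
      (hmax hA) (hmax hB)).trans ?_
    exact Finset.sum_le_sum fun p _ =>
      mul_le_mul_of_nonneg_left (ih _ _ (hslice hA p) (hslice hB p)) (hμ0 p)


/-- **Abstract form of the generalized Harris lemma** (Lemma 3.2).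
For a finite poset `P` with greatest element `x₀` of positive probability,
there is a function `F : (0,1]² → (0,1]`, strictly increasing in each argument,
such that for any `n ≥ 1` and any two upsets `A`, `B` of positive measure in
`P^n`, we have `μⁿ(A ∩ B) ≥ F(μⁿ(A), μⁿ(B))`. -/
theorem abstract_generalized_harris (P : Type) [Fintype P] [PartialOrder P]
    (x0 : P) (hx0 : ∀ x : P, x ≤ x0)
    (μ : P → ℝ) (hμ0 : ∀ x, 0 ≤ μ x) (hμ1 : ∑ x : P, μ x = 1) (hpos : 0 < μ x0) :
    ∃ F : ℝ → ℝ → ℝ,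
      (∀ a ∈ Set.Ioc (0 : ℝ) 1, ∀ b ∈ Set.Ioc (0 : ℝ) 1, F a b ∈ Set.Ioc (0 : ℝ) 1) ∧
      (∀ b ∈ Set.Ioc (0 : ℝ) 1, StrictMonoOn (fun a => F a b) (Set.Ioc (0 : ℝ) 1)) ∧
      (∀ a ∈ Set.Ioc (0 : ℝ) 1, StrictMonoOn (fun b => F a b) (Set.Ioc (0 : ℝ) 1)) ∧
      ∀ (n : ℕ), 1 ≤ n → ∀ A B : Set (Fin n → P),
        IsUpperSet A → IsUpperSet B →
        0 < (∑ x : Fin n → P, A.indicator (fun y => ∏ i, μ (y i)) x) →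
        0 < (∑ x : Fin n → P, B.indicator (fun y => ∏ i, μ (y i)) x) →
        (∑ x : Fin n → P, (A ∩ B).indicator (fun y => ∏ i, μ (y i)) x) ≥
          F (∑ x : Fin n → P, A.indicator (fun y => ∏ i, μ (y i)) x)
            (∑ x : Fin n → P, B.indicator (fun y => ∏ i, μ (y i)) x) := by
  obtain ⟨k, hk⟩ := exists_nat_ge (2 / μ x0)
  have hC : 2 ≤ μ x0 * (((k + 1 : ℕ) : ℝ) - 1) := by
    rw [div_le_iff₀ hpos] at hk
    push_cast
    linarith
  refine ⟨fun a b => (a * b) ^ (k + 1), ?_, ?_, ?_, ?_⟩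
  · rintro a ⟨ha0, ha1⟩ b ⟨hb0, hb1⟩
    exact ⟨by positivity, pow_le_one₀ (by positivity) (mul_le_one₀ ha1 hb0.le hb1)⟩
  · rintro b ⟨hb0, -⟩ a ⟨ha0, -⟩ a' - haa'
    exact pow_lt_pow_left₀ (mul_lt_mul_of_pos_right haa' hb0) (by positivity) k.succ_ne_zero
  · rintro a ⟨ha0, -⟩ b ⟨hb0, -⟩ b' - hbb'
    exact pow_lt_pow_left₀ (mul_lt_mul_of_pos_left hbb' ha0) (by positivity) k.succ_ne_zero
  · intro n _ A B hA hB _ _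
    exact pow_mul_le_sum_indicator_inter hx0 hμ0 hμ1 k.succ_ne_zero hC n A B hA hB
end

section
/- Near-vertical crossings of squares (Lemma 5.2): There is a constant c_2 > 0 such that the following holds for every integer n ≥ 1 and all integers a, b. Let S = [a, a+n] × [b, b+n], and let E(S) be the event that there is an open vertical crossing of S whose first vertex (x, b) and last vertex (x', b+n) satisfy |x − x'| ≤ 3n/5. Then Pr(E(S)) ≥ c_2. -/
open MeasureTheory

/-- A bond of the grid `ℤ²`: `(v, true)` is the bond joining `v` to `v + (1,0)`,
and `(v, false)` is the bond joining `v` to `v + (0,1)`. -/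
abbrev GridBond : Type := (ℤ × ℤ) × Bool

/-- A percolation configuration: each bond is open (`true`) or closed (`false`). -/
abbrev PercCfg : Type := GridBond → Bool

/-- The vertices `u` and `v` are adjacent in `ℤ²` and the bond joining them is
open in the configuration `ω`. -/
def BondOpen (ω : PercCfg) (u v : ℤ × ℤ) : Prop :=
  (v = (u.1 + 1, u.2) ∧ ω (u, true) = true) ∨
  (u = (v.1 + 1, v.2) ∧ ω (v, true) = true) ∨
  (v = (u.1, u.2 + 1) ∧ ω (u, false) = true) ∨
  (u = (v.1, v.2 + 1) ∧ ω (v, false) = true)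

/-- `v` lies in the rectangle `[a,b] × [c,d]` of `ℤ²`. -/
def InRect (a b c d : ℤ) (v : ℤ × ℤ) : Prop :=
  a ≤ v.1 ∧ v.1 ≤ b ∧ c ≤ v.2 ∧ v.2 ≤ d

/-- `Pth 0, Pth 1, …, Pth k` is an open lattice path in the rectangle
`[a,b] × [c,d]`. -/
def OpenPathIn (ω : PercCfg) (a b c d : ℤ) (k : ℕ) (Pth : ℕ → ℤ × ℤ) : Prop :=
  (∀ i ≤ k, InRect a b c d (Pth i)) ∧ ∀ i < k, BondOpen ω (Pth i) (Pth (i + 1))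

/-- The event that `[a,b] × [c,d]` has an open horizontal crossing. -/
def HCross (a b c d : ℤ) : Set PercCfg :=
  {ω | ∃ k Pth, OpenPathIn ω a b c d k Pth ∧ (Pth 0).1 = a ∧ (Pth k).1 = b}

/-- The event that `[a,b] × [c,d]` has an open vertical crossing. -/
def VCross (a b c d : ℤ) : Set PercCfg :=
  {ω | ∃ k Pth, OpenPathIn ω a b c d k Pth ∧ (Pth 0).2 = c ∧ (Pth k).2 = d}

/-- `Pr` is the i.i.d. Bernoulli(1/2) bond percolation measure on `ℤ²`: a
probability measure under which the states of the bonds are independent, each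
open with probability `1/2`. -/
def IsBondPerc (Pr : Measure PercCfg) : Prop :=
  IsProbabilityMeasure Pr ∧
    ∀ (s : Finset GridBond) (f : GridBond → Bool),
      Pr {ω | ∀ e ∈ s, ω e = f e} = (1 / 2 : ENNReal) ^ s.card

/-! ### Invariance and positive association of bond percolation -/

/-- An event is increasing and determined by the bonds in `s`. -/
def IncreasingOn (s : Finset GridBond) (A : Set PercCfg) : Prop :=
  ∀ ω ω' : PercCfg, (∀ e ∈ s, ω e = true → ω' e = true) → ω ∈ A → ω' ∈ A

/-- The configuration whose open bonds are those of `t`. -/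
noncomputable def cfgOf {s : Finset GridBond} (t : Finset s) : PercCfg :=
  fun e => decide (∃ h : e ∈ s, (⟨e, h⟩ : s) ∈ t)

open Classical in
/-- The sets of open bonds in `s` for which the event `A` occurs. -/
noncomputable def openSets (s : Finset GridBond) (A : Set PercCfg) : Finset (Finset s) :=
  Finset.univ.filter fun t => cfgOf t ∈ A

lemma cfgOf_eq_true {s : Finset GridBond} (t : Finset s) (e : GridBond) :
    cfgOf t e = true ↔ ∃ h : e ∈ s, (⟨e, h⟩ : s) ∈ t := by
  simp [cfgOf]

lemma IncreasingOn.eq_biUnion {s : Finset GridBond} {A : Set PercCfg} (hA : IncreasingOn s A) :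
    A = ⋃ t ∈ openSets s A, {ω : PercCfg | ∀ e ∈ s, ω e = cfgOf t e} := by
  ext ω
  simp only [Set.mem_iUnion, Set.mem_ofPred_eq, exists_prop, openSets, Finset.mem_filter,
    Finset.mem_univ, true_and]
  constructor
  · intro hω
    have key : ∀ e ∈ s, ω e = cfgOf (Finset.univ.filter fun e : s => ω e = true) e := by
      intro e he
      rw [Bool.eq_iff_iff, cfgOf_eq_true]
      simp [he]
    exact ⟨_, hA ω _ (fun e he h => by rw [← key e he]; exact h) hω, key⟩
  · rintro ⟨t, ht, h⟩
    exact hA _ ω (fun e he h' => by rw [h e he]; exact h') ht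

lemma measurableSet_cylinder (s : Finset GridBond) (f : PercCfg) :
    MeasurableSet {ω : PercCfg | ∀ e ∈ s, ω e = f e} := by
  have : {ω : PercCfg | ∀ e ∈ s, ω e = f e} = ⋂ e ∈ s, (fun ω : PercCfg => ω e) ⁻¹' {f e} := by
    ext ω; simp
  rw [this]
  exact Finset.measurableSet_biInter _ fun e _ => measurable_pi_apply e (measurableSet_singleton _)

lemma IncreasingOn.measurableSet {s : Finset GridBond} {A : Set PercCfg}
    (hA : IncreasingOn s A) : MeasurableSet A := by
  rw [hA.eq_biUnion]
  exact Finset.measurableSet_biUnion _ fun t _ => measurableSet_cylinder s _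

lemma IncreasingOn.measure_eq {s : Finset GridBond} {A : Set PercCfg} (hA : IncreasingOn s A)
    {Pr : Measure PercCfg} (hPr : IsBondPerc Pr) :
    Pr A = (openSets s A).card * (1 / 2 : ENNReal) ^ s.card := by
  conv_lhs => rw [hA.eq_biUnion]
  rw [measure_biUnion_finset]
  · simp only [hPr.2, Finset.sum_const, nsmul_eq_mul]
  · intro t _ t' _ htt'
    refine Set.disjoint_left.2 fun ω h h' => htt' ?_
    ext ⟨e, he⟩
    have h1 : cfgOf t e = cfgOf t' e := (h e he).symm.trans (h' e he)
    have h2 := cfgOf_eq_true t e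
    rw [h1, cfgOf_eq_true] at h2
    simpa [he] using h2.symm
  · exact fun t _ => measurableSet_cylinder s _

/-- Harris' inequality. -/
lemma IncreasingOn.mul_le_measure_inter {s : Finset GridBond} {A B : Set PercCfg}
    (hA : IncreasingOn s A) (hB : IncreasingOn s B) {Pr : Measure PercCfg}
    (hPr : IsBondPerc Pr) : Pr A * Pr B ≤ Pr (A ∩ B) := by
  classical
  have hAB : IncreasingOn s (A ∩ B) := fun ω ω' h hω => ⟨hA ω ω' h hω.1, hB ω ω' h hω.2⟩
  have upper : ∀ {C : Set PercCfg}, IncreasingOn s C →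
      IsUpperSet (openSets s C : Set (Finset s)) := by
    intro C hC t t' htt' ht
    simp only [openSets, Finset.coe_filter, Finset.mem_univ, true_and, Set.mem_ofPred_eq] at ht ⊢
    refine hC _ _ (fun e _ h => ?_) ht
    rw [cfgOf_eq_true] at h ⊢
    exact h.imp fun _ h => htt' h
  have key := (upper hA).le_card_inter_finset (upper hB)
  have hinter : openSets s A ∩ openSets s B = openSets s (A ∩ B) := by
    ext t; simp [openSets]
  rw [hinter, Fintype.card_coe] at key
  rw [hA.measure_eq hPr, hB.measure_eq hPr, hAB.measure_eq hPr]
  have h2 : (2 : ENNReal) ^ s.card * (1 / 2 : ENNReal) ^ s.card = 1 := by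
    rw [← mul_pow, one_div, ENNReal.mul_inv_cancel (by norm_num) (by norm_num), one_pow]
  set r : ENNReal := (1 / 2 : ENNReal) ^ s.card
  calc ((openSets s A).card : ENNReal) * r * ((openSets s B).card * r)
      = ((openSets s A).card * (openSets s B).card : ℕ) * (r * r) := by push_cast; ring
    _ ≤ (2 ^ s.card * (openSets s (A ∩ B)).card : ℕ) * (r * r) := by gcongr
    _ = (2 ^ s.card * r) * ((openSets s (A ∩ B)).card * r) := by push_cast; ring
    _ = (openSets s (A ∩ B)).card * r := by rw [h2, one_mul]

/-- Relabel the bonds by `σ`, and exchange open and closed if `c = true`. -/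
def relabel (σ : Equiv.Perm GridBond) (c : Bool) (ω : PercCfg) : PercCfg :=
  fun e => xor c (ω (σ e))

lemma measurable_relabel (σ : Equiv.Perm GridBond) (c : Bool) : Measurable (relabel σ c) :=
  measurable_pi_iff.2 fun e => (measurable_of_finite (xor c)).comp (measurable_pi_apply (σ e))

lemma IsBondPerc.map_relabel {Pr : Measure PercCfg} (hPr : IsBondPerc Pr)
    (σ : Equiv.Perm GridBond) (c : Bool) : IsBondPerc (Pr.map (relabel σ c)) := by
  have := hPr.1
  refine ⟨Measure.isProbabilityMeasure_map (measurable_relabel σ c).aemeasurable, fun s f => ?_⟩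
  rw [Measure.map_apply (measurable_relabel σ c) (measurableSet_cylinder s f)]
  have h : relabel σ c ⁻¹' {ω : PercCfg | ∀ e ∈ s, ω e = f e} =
      {ω : PercCfg | ∀ e ∈ s.map σ.toEmbedding, ω e = xor c (f (σ.symm e))} := by
    ext ω
    simp only [relabel, Set.mem_preimage, Set.mem_ofPred_eq, Finset.mem_map,
      Equiv.coe_toEmbedding, forall_exists_index, and_imp, forall_apply_eq_imp_iff₂,
      Equiv.symm_apply_apply]
    refine forall₂_congr fun e _ => ?_
    cases c <;> cases ω (σ e) <;> cases f e <;> simp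
  rw [h, hPr.2, Finset.card_map]

lemma IncreasingOn.measure_preimage_relabel {s : Finset GridBond} {A : Set PercCfg}
    (hA : IncreasingOn s A) {Pr : Measure PercCfg} (hPr : IsBondPerc Pr)
    (σ : Equiv.Perm GridBond) (c : Bool) : Pr (relabel σ c ⁻¹' A) = Pr A := by
  rw [← Measure.map_apply (measurable_relabel σ c) hA.measurableSet,
    hA.measure_eq (hPr.map_relabel σ c), hA.measure_eq hPr]

/-! ### Open paths -/

/-- One step of an open path in `[0,m] × [0,n]`. -/
def OpenStep (ω : PercCfg) (m n : ℤ) (u v : ℤ × ℤ) : Prop :=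
  InRect 0 m 0 n u ∧ InRect 0 m 0 n v ∧ BondOpen ω u v

lemma OpenPathIn.reflTransGen {ω : PercCfg} {m n : ℤ} {k : ℕ} {P : ℕ → ℤ × ℤ}
    (h : OpenPathIn ω 0 m 0 n k P) {i j : ℕ} (hij : i ≤ j) (hj : j ≤ k) :
    Relation.ReflTransGen (OpenStep ω m n) (P i) (P j) := by
  induction j, hij using Nat.le_induction with
  | base => exact .refl
  | succ j _ ih =>
    exact (ih (by omega)).tail ⟨h.1 j (by omega), h.1 (j + 1) hj, h.2 j (by omega)⟩

lemma exists_openPathIn {ω : PercCfg} {m n : ℤ} {u v : ℤ × ℤ} (hu : InRect 0 m 0 n u)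
    (h : Relation.ReflTransGen (OpenStep ω m n) u v) :
    ∃ k P, OpenPathIn ω 0 m 0 n k P ∧ P 0 = u ∧ P k = v := by
  induction h with
  | refl => exact ⟨0, fun _ => u, ⟨fun _ _ => hu, fun i hi => by omega⟩, rfl, rfl⟩
  | @tail v w _ hvw ih =>
    obtain ⟨k, P, hP, h0, hk⟩ := ih
    refine ⟨k + 1, fun i => if i ≤ k then P i else w, ⟨fun i _ => ?_, fun i hi => ?_⟩, ?_, ?_⟩
    · by_cases hi : i ≤ k
      · simpa [hi] using hP.1 i hi
      · simpa [hi] using hvw.2.1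
    · rcases Nat.lt_succ_iff_lt_or_eq.1 hi with hi | rfl
      · simpa [hi.le, Nat.succ_le_of_lt hi] using hP.2 i hi
      · simpa [hk] using hvw.2.2
    · simpa using h0
    · simp

lemma BondOpen.mono {ω ω' : PercCfg} {n : ℕ} {u v : ℤ × ℤ} (hu : InRect 0 n 0 n u)
    (hv : InRect 0 n 0 n v)
    (h : ∀ e ∈ (Finset.Icc (0 : ℤ) n ×ˢ Finset.Icc (0 : ℤ) n) ×ˢ (Finset.univ : Finset Bool),
      ω e = true → ω' e = true) (huv : BondOpen ω u v) : BondOpen ω' u v := by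
  have hu' : ∀ c, ω (u, c) = true → ω' (u, c) = true := fun c => h _ (by
    simp only [Finset.mem_product, Finset.mem_Icc, Finset.mem_univ, and_true]
    exact ⟨⟨hu.1, hu.2.1⟩, hu.2.2⟩)
  have hv' : ∀ c, ω (v, c) = true → ω' (v, c) = true := fun c => h _ (by
    simp only [Finset.mem_product, Finset.mem_Icc, Finset.mem_univ, and_true]
    exact ⟨⟨hv.1, hv.2.1⟩, hv.2.2⟩)
  exact huv.imp (.imp_right (hu' _)) (.imp (.imp_right (hv' _))
    (.imp (.imp_right (hu' _)) (.imp_right (hv' _))))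

/-- Some open vertical crossing of `[0,n] × [0,n]` has endpoints `u`, `v` with `p u v`. -/
def CrossWith (n : ℕ) (p : ℤ × ℤ → ℤ × ℤ → Prop) : Set PercCfg :=
  {ω | ∃ k P, OpenPathIn ω 0 n 0 n k P ∧ (P 0).2 = 0 ∧ (P k).2 = n ∧ p (P 0) (P k)}

lemma increasingOn_crossWith (n : ℕ) (p : ℤ × ℤ → ℤ × ℤ → Prop) :
    IncreasingOn ((Finset.Icc (0 : ℤ) n ×ˢ Finset.Icc (0 : ℤ) n) ×ˢ Finset.univ)
      (CrossWith n p) := by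
  rintro ω ω' h ⟨k, P, hP, h0⟩
  exact ⟨k, P, ⟨hP.1, fun i hi =>
    (hP.2 i hi).mono (hP.1 i hi.le) (hP.1 (i + 1) hi) h⟩, h0⟩

/-! ### Two paths in a square which exchange their order must meet -/

/-- Parity of the crossings of the step from `p` to `q` with the ray going right from
`v + (1/2, 1/2)`. -/
def rayCross (p q v : ℤ × ℤ) : ZMod 2 :=
  if v.1 < p.1 ∧ v.1 < q.1 ∧
    ((p.2 = v.2 ∧ q.2 = v.2 + 1) ∨ (q.2 = v.2 ∧ p.2 = v.2 + 1)) then 1 else 0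

/-- Indicator of the lattice points strictly to the right of `v`. -/
def rightOf (v p : ℤ × ℤ) : ZMod 2 := if p.2 = v.2 ∧ v.1 < p.1 then 1 else 0

/-- Parity of the crossings of the path `P`, continued upwards from its last vertex `P k`,
with the ray going right from `v + (1/2, 1/2)`. -/
def rayParity (P : ℕ → ℤ × ℤ) (k : ℕ) (v : ℤ × ℤ) : ZMod 2 :=
  ∑ i ∈ Finset.range k, rayCross (P i) (P (i + 1)) v + rightOf v (P k)

lemma sum_range_add_succ (g : ℕ → ZMod 2) (k : ℕ) :
    ∑ i ∈ Finset.range k, (g i + g (i + 1)) = g 0 + g k := by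
  have h2 : ∀ a b c : ZMod 2, a + b + (b + c) = a + c := by decide
  induction k with
  | zero => simp only [Finset.range_zero, Finset.sum_empty]; exact (CharTwo.add_self_eq_zero _).symm
  | succ k ih => rw [Finset.sum_range_succ, ih, h2]

lemma rayCross_right {ω : PercCfg} {p q v : ℤ × ℤ} (hpq : BondOpen ω p q)
    (hp : p ≠ (v.1 + 1, v.2)) (hq : q ≠ (v.1 + 1, v.2)) :
    rayCross p q v = rayCross p q (v.1 + 1, v.2) := by
  obtain ⟨p1, p2⟩ := p
  obtain ⟨q1, q2⟩ := q
  obtain ⟨v1, v2⟩ := v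
  simp only [BondOpen, rayCross, Prod.mk.injEq, ne_eq, not_and] at *
  congr 1
  rw [eq_iff_iff]
  omega

lemma rayCross_up {ω : PercCfg} {p q v : ℤ × ℤ} (hpq : BondOpen ω p q)
    (hp : p ≠ (v.1, v.2 + 1)) (hq : q ≠ (v.1, v.2 + 1)) :
    rayCross p q v + rayCross p q (v.1, v.2 + 1) =
      rightOf (v.1, v.2 + 1) p + rightOf (v.1, v.2 + 1) q := by
  obtain ⟨p1, p2⟩ := p
  obtain ⟨q1, q2⟩ := q
  obtain ⟨v1, v2⟩ := v
  simp only [BondOpen, rayCross, rightOf, Prod.mk.injEq, ne_eq, not_and] at *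
  split_ifs <;> first | rfl | (exfalso; omega)

lemma rayParity_right {ω : PercCfg} {n : ℤ} {k : ℕ} {P : ℕ → ℤ × ℤ}
    (hP : OpenPathIn ω 0 n 0 n k P) {v : ℤ × ℤ}
    (hv : ∀ i ≤ k, P i ≠ (v.1 + 1, v.2)) :
    rayParity P k v = rayParity P k (v.1 + 1, v.2) := by
  unfold rayParity
  congr 1
  · refine Finset.sum_congr rfl fun i hi => ?_
    have hi := Finset.mem_range.1 hi
    exact rayCross_right (hP.2 i hi) (hv i hi.le) (hv (i + 1) hi)
  · have := hv k le_rfl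
    simp only [rightOf]
    congr 1
    rw [ne_eq, Prod.ext_iff] at this
    rw [eq_iff_iff]
    simp only at *
    omega

lemma rayParity_up {ω : PercCfg} {n : ℤ} {k : ℕ} {P : ℕ → ℤ × ℤ}
    (hP : OpenPathIn ω 0 n 0 n k P) (h0 : (P 0).2 = 0) (hk : (P k).2 = n) {v : ℤ × ℤ}
    (hv0 : 0 ≤ v.2) (hvn : v.2 < n) (hv : ∀ i ≤ k, P i ≠ (v.1, v.2 + 1)) :
    rayParity P k v = rayParity P k (v.1, v.2 + 1) := by
  have hsum : ∑ i ∈ Finset.range k, rayCross (P i) (P (i + 1)) v +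
      ∑ i ∈ Finset.range k, rayCross (P i) (P (i + 1)) (v.1, v.2 + 1) =
      rightOf (v.1, v.2 + 1) (P 0) + rightOf (v.1, v.2 + 1) (P k) := by
    rw [← Finset.sum_add_distrib, ← sum_range_add_succ fun i => rightOf (v.1, v.2 + 1) (P i)]
    refine Finset.sum_congr rfl fun i hi => ?_
    have hi := Finset.mem_range.1 hi
    exact rayCross_up (hP.2 i hi) (hv i hi.le) (hv (i + 1) hi)
  have h1 : rightOf (v.1, v.2 + 1) (P 0) = 0 := if_neg (by simp only; omega)
  have h2 : rightOf v (P k) = 0 := if_neg (by omega)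
  rw [h1, zero_add] at hsum
  rw [rayParity, rayParity, h2, ← hsum, add_zero]
  have h3 : ∀ a b : ZMod 2, a = b + (a + b) := by decide
  exact h3 _ _

lemma rayParity_bottom {ω : PercCfg} {n : ℤ} (hn : 0 < n) {k : ℕ} {P : ℕ → ℤ × ℤ}
    (hP : OpenPathIn ω 0 n 0 n k P) (hk : (P k).2 = n) {v : ℤ × ℤ}
    (hv0 : v.2 = 0) (hv : ∀ i ≤ k, P i ≠ v) (hlt : (P 0).1 < v.1) : rayParity P k v = 0 := by
  have hsum : ∑ i ∈ Finset.range k, rayCross (P i) (P (i + 1)) v =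
      rightOf v (P 0) + rightOf v (P k) := by
    rw [← sum_range_add_succ fun i => rightOf v (P i)]
    refine Finset.sum_congr rfl fun i hi => ?_
    have hi := Finset.mem_range.1 hi
    have hup := rayCross_up (v := (v.1, v.2 - 1)) (hP.2 i hi) (by simpa using hv i hi.le)
      (by simpa using hv (i + 1) hi)
    have h1 := (hP.1 i hi.le).2.2.1
    have h2 := (hP.1 (i + 1) hi).2.2.1
    have h3 : rayCross (P i) (P (i + 1)) (v.1, v.2 - 1) = 0 := if_neg (by simp only; omega)
    simpa [h3] using hup
  have h1 : rightOf v (P 0) = 0 := if_neg (by omega)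
  have h2 : rightOf v (P k) = 0 := if_neg (by omega)
  rw [rayParity, hsum, h1, h2]
  rfl

lemma rayParity_top {ω : PercCfg} {n : ℤ} {k : ℕ} {P : ℕ → ℤ × ℤ}
    (hP : OpenPathIn ω 0 n 0 n k P) (hk : (P k).2 = n) {v : ℤ × ℤ}
    (hvn : v.2 = n) (hlt : v.1 < (P k).1) : rayParity P k v = 1 := by
  have hsum : ∑ i ∈ Finset.range k, rayCross (P i) (P (i + 1)) v = 0 := by
    refine Finset.sum_eq_zero fun i hi => if_neg ?_
    have hi := Finset.mem_range.1 hi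
    have h1 := (hP.1 i hi.le).2.2.2
    have h2 := (hP.1 (i + 1) hi).2.2.2
    omega
  rw [rayParity, hsum, zero_add]
  exact if_pos (by omega)

lemma rayParity_eq_of_bondOpen {ω : PercCfg} {n : ℤ} {k : ℕ} {P : ℕ → ℤ × ℤ}
    (hP : OpenPathIn ω 0 n 0 n k P) (h0 : (P 0).2 = 0) (hk : (P k).2 = n) {u v : ℤ × ℤ}
    (hu : InRect 0 n 0 n u) (hv : InRect 0 n 0 n v) (huv : BondOpen ω u v)
    (hPu : ∀ i ≤ k, P i ≠ u) (hPv : ∀ i ≤ k, P i ≠ v) :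
    rayParity P k u = rayParity P k v := by
  rcases huv with ⟨rfl, -⟩ | ⟨rfl, -⟩ | ⟨rfl, -⟩ | ⟨rfl, -⟩
  · exact rayParity_right hP hPv
  · exact (rayParity_right hP hPu).symm
  · exact rayParity_up hP h0 hk hu.2.2.1 (Int.lt_of_add_one_le hv.2.2.2) hPv
  · exact (rayParity_up hP h0 hk hv.2.2.1 (Int.lt_of_add_one_le hu.2.2.2) hPu).symm

/-- Two vertical crossings of a square whose endpoints are in opposite orders share a vertex. -/
lemma exists_common_vertex {ω : PercCfg} {n : ℤ} (hn : 0 < n) {k l : ℕ} {P Q : ℕ → ℤ × ℤ}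
    (hP : OpenPathIn ω 0 n 0 n k P) (hP0 : (P 0).2 = 0) (hPk : (P k).2 = n)
    (hQ : OpenPathIn ω 0 n 0 n l Q) (hQ0 : (Q 0).2 = 0) (hQl : (Q l).2 = n)
    (hbot : (P 0).1 < (Q 0).1) (htop : (Q l).1 < (P k).1) :
    ∃ i ≤ k, ∃ j ≤ l, P i = Q j := by
  by_contra! hne
  have hconst : ∀ j ≤ l, rayParity P k (Q j) = 0 := by
    intro j hj
    induction j with
    | zero => exact rayParity_bottom hn hP hPk hQ0 (fun i hi => hne i hi 0 hj) hbot
    | succ j ih =>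
      rw [← rayParity_eq_of_bondOpen hP hP0 hPk (hQ.1 j (by omega)) (hQ.1 (j + 1) hj)
        (hQ.2 j hj) (fun i hi => hne i hi j (by omega)) (fun i hi => hne i hi (j + 1) hj)]
      exact ih (by omega)
  have := hconst l le_rfl
  rw [rayParity_top hP hPk hQl htop] at this
  exact one_ne_zero this

/-! ### Duality: squares are crossed with probability at least `1/2` -/

/-- Summation by parts: an indicator on the vertices of a rectangle that separates bottom from top
and an indicator on its faces that separates left from right change across a common bond. -/
lemma no_two_separations (N : ℕ) (f g : ℕ → ℕ → ℤ)
    (fbot : ∀ i ≤ N, f i 0 = 1) (ftop : ∀ i ≤ N, f i (N + 1) = 0)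
    (gleft : ∀ j ≤ N, g 0 j = 1) (gright : ∀ j ≤ N, g (N + 1) j = 0)
    (hvert : ∀ i ≤ N, ∀ j ≤ N, (f i (j + 1) - f i j) * (g (i + 1) j - g i j) = 0)
    (hhor : ∀ i < N, ∀ j < N,
      (f (i + 1) (j + 1) - f i (j + 1)) * (g (i + 1) (j + 1) - g (i + 1) j) = 0) : False := by
  have across : ∀ i ≤ N, ∑ j ∈ Finset.range (N + 1), (f i (j + 1) - f i j) * g (i + 1) j =
      ∑ j ∈ Finset.range (N + 1), (f i (j + 1) - f i j) * g i j := fun i hi =>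
    Finset.sum_congr rfl fun j hj => by
      linear_combination hvert i hi j (Nat.lt_succ_iff.1 (Finset.mem_range.1 hj))
  have along : ∀ i < N, ∀ l ≤ N,
      ∑ j ∈ Finset.range (l + 1), (f (i + 1) (j + 1) - f (i + 1) j) * g (i + 1) j =
      ∑ j ∈ Finset.range (l + 1), (f i (j + 1) - f i j) * g (i + 1) j +
        (f (i + 1) (l + 1) - f i (l + 1)) * g (i + 1) l := by
    intro i hi l hl
    induction l with
    | zero =>
      simp only [zero_add, Finset.sum_range_one]
      rw [fbot i hi.le, fbot (i + 1) hi]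
      ring
    | succ l ih =>
      rw [Finset.sum_range_succ, ih (by omega), Finset.sum_range_succ _ (l + 1)]
      linear_combination -hhor i hi l hl
  have total : ∀ i ≤ N,
      ∑ j ∈ Finset.range (N + 1), (f i (j + 1) - f i j) * g (i + 1) j = -1 := by
    intro i hi
    induction i with
    | zero =>
      rw [across 0 hi, Finset.sum_congr rfl (g := fun j => f 0 (j + 1) - f 0 j) fun j hj => by
        rw [gleft j (Nat.lt_succ_iff.1 (Finset.mem_range.1 hj)), mul_one],
        Finset.sum_range_sub (f 0), ftop 0 hi, fbot 0 hi]
      norm_num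
    | succ i ih =>
      rw [across (i + 1) hi, along i hi N le_rfl, ih (by omega), ftop i (by omega), ftop _ hi]
      ring
  have := total N le_rfl
  rw [Finset.sum_eq_zero fun j hj => by
    rw [gright j (Nat.lt_succ_iff.1 (Finset.mem_range.1 hj)), mul_zero]] at this
  norm_num at this

/-- `v` is joined to the bottom side of `[0,m] × [0,n]` by an open path. -/
def JoinedToBottom (ω : PercCfg) (m n : ℤ) (v : ℤ × ℤ) : Prop :=
  ∃ u : ℤ × ℤ, u.2 = 0 ∧ InRect 0 m 0 n u ∧ Relation.ReflTransGen (OpenStep ω m n) u v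

lemma BondOpen.symm {ω : PercCfg} {u v : ℤ × ℤ} (h : BondOpen ω u v) : BondOpen ω v u := by
  unfold BondOpen at *
  tauto

lemma JoinedToBottom.iff_of_bondOpen {ω : PercCfg} {m n : ℤ} {u v : ℤ × ℤ}
    (hu : InRect 0 m 0 n u) (hv : InRect 0 m 0 n v) (huv : BondOpen ω u v) :
    JoinedToBottom ω m n u ↔ JoinedToBottom ω m n v :=
  ⟨fun ⟨w, h0, hw, h⟩ => ⟨w, h0, hw, h.tail ⟨hu, hv, huv⟩⟩,
    fun ⟨w, h0, hw, h⟩ => ⟨w, h0, hw, h.tail ⟨hv, hu, huv.symm⟩⟩⟩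

/-- The bijection between the bonds of `ℤ²` and those of its dual lattice, the latter identified
with `ℤ²` by a transposition. -/
def dualPerm : Equiv.Perm GridBond :=
  Function.Involutive.toPerm
    (fun e => if e.2 then ((e.1.2 - 1, e.1.1 + 1), true) else ((e.1.2, e.1.1), false))
    (by rintro ⟨⟨x, y⟩, _ | _⟩ <;> simp)

@[simp]
lemma dualPerm_true (x y : ℤ) : dualPerm ((x, y), true) = ((y - 1, x + 1), true) := rfl

@[simp]
lemma dualPerm_false (x y : ℤ) : dualPerm ((x, y), false) = ((y, x), false) := rfl

lemma crossing_or_dual_crossing (ω : PercCfg) (N : ℕ) :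
    (∃ i : ℕ, i ≤ N ∧ JoinedToBottom ω N (N + 1) (i, N + 1)) ∨
    ∃ j : ℕ, j ≤ N ∧ JoinedToBottom (relabel dualPerm true ω) N (N + 1) (j, N + 1) := by
  classical
  by_contra! ⟨hf, hg⟩
  set ω' := relabel dualPerm true ω with hω'
  have hrect : ∀ {i j : ℕ}, i ≤ N → j ≤ N + 1 → InRect 0 N 0 (N + 1) ((i : ℤ), (j : ℤ)) := by
    intro i j hi hj
    simp only [InRect]
    omega
  refine no_two_separations N
    (fun i j => if JoinedToBottom ω N (N + 1) (i, j) then 1 else 0)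
    (fun i j => if JoinedToBottom ω' N (N + 1) (j, i) then 1 else 0)
    (fun i hi => if_pos ⟨_, rfl, hrect hi (by omega), .refl⟩)
    (fun i hi => if_neg (by simpa using hf i hi))
    (fun j hj => if_pos ⟨_, rfl, hrect hj (by omega), .refl⟩)
    (fun j hj => if_neg (by simpa using hg j hj)) ?_ ?_
  · intro i hi j hj
    have h1 := hrect hi (show j ≤ N + 1 by omega)
    have h2 := hrect hi (show j + 1 ≤ N + 1 by omega)
    have h3 := hrect hj (show i ≤ N + 1 by omega)
    have h4 := hrect hj (show i + 1 ≤ N + 1 by omega)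
    by_cases hb : ω (((i : ℤ), (j : ℤ)), false) = true
    · have := JoinedToBottom.iff_of_bondOpen h1 h2
        (Or.inr (Or.inr (Or.inl ⟨by push_cast; rfl, hb⟩)))
      simp only [this, sub_self, zero_mul]
    · have hb' : ω' (((j : ℤ), (i : ℤ)), false) = true := by
        simpa [hω', relabel] using hb
      have := JoinedToBottom.iff_of_bondOpen h3 h4
        (Or.inr (Or.inr (Or.inl ⟨by push_cast; rfl, hb'⟩)))
      simp only [this, sub_self, mul_zero]
  · intro i hi j hj
    have h1 := hrect hi.le (show j + 1 ≤ N + 1 by omega)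
    have h2 := hrect (Nat.succ_le_of_lt hi) (show j + 1 ≤ N + 1 by omega)
    have h3 := hrect hj.le (show i + 1 ≤ N + 1 by omega)
    have h4 := hrect (Nat.succ_le_of_lt hj) (show i + 1 ≤ N + 1 by omega)
    by_cases hb : ω (((i : ℤ), ((j + 1 : ℕ) : ℤ)), true) = true
    · have := JoinedToBottom.iff_of_bondOpen h1 h2 (Or.inl ⟨by push_cast; rfl, hb⟩)
      simp only [Nat.succ_eq_add_one] at this
      simp only [this, sub_self, zero_mul]
    · have hb' : ω' (((j : ℤ), ((i + 1 : ℕ) : ℤ)), true) = true := by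
        simpa [hω', relabel] using hb
      have := JoinedToBottom.iff_of_bondOpen h3 h4 (Or.inl ⟨by push_cast; rfl, hb'⟩)
      simp only [Nat.succ_eq_add_one] at this
      simp only [this, sub_self, mul_zero]

lemma JoinedToBottom.mem_crossWith {ω : PercCfg} {N i : ℕ}
    (h : JoinedToBottom ω N (N + 1) (i, N + 1)) :
    ω ∈ CrossWith (N + 1) fun _ _ => True := by
  obtain ⟨u, hu0, hu, h⟩ := h
  obtain ⟨k, P, hP, h0, hk⟩ := exists_openPathIn hu h
  refine ⟨k, P, ⟨fun i hi => ?_, hP.2⟩, by rw [h0, hu0], by rw [hk]; push_cast; rfl, trivial⟩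
  have := hP.1 i hi
  unfold InRect at *
  push_cast
  omega

lemma one_le_two_mul_measure_crossWith {Pr : Measure PercCfg} (hPr : IsBondPerc Pr) {n : ℕ}
    (hn : 1 ≤ n) : 1 ≤ 2 * Pr (CrossWith n fun _ _ => True) := by
  obtain ⟨N, rfl⟩ := Nat.exists_eq_add_of_le' hn
  set V := CrossWith (N + 1) fun _ _ => True with hV
  have := hPr.1
  calc 1 = Pr Set.univ := measure_univ.symm
    _ ≤ Pr (V ∪ relabel dualPerm true ⁻¹' V) := measure_mono fun ω _ =>
        (crossing_or_dual_crossing ω N).imp (fun ⟨_, _, h⟩ => h.mem_crossWith)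
          (fun ⟨_, _, h⟩ => h.mem_crossWith)
    _ ≤ Pr V + Pr (relabel dualPerm true ⁻¹' V) := measure_union_le _ _
    _ = 2 * Pr V := by
        rw [(increasingOn_crossWith _ _).measure_preimage_relabel hPr, two_mul]

/-! ### Near-vertical crossings -/

/-- The reflection of `[0,n] × ℤ` in its vertical axis, acting on bonds. -/
def reflectPerm (n : ℤ) : Equiv.Perm GridBond :=
  Function.Involutive.toPerm
    (fun e => if e.2 then ((n - 1 - e.1.1, e.1.2), true) else ((n - e.1.1, e.1.2), false))
    (by rintro ⟨⟨x, y⟩, _ | _⟩ <;> simp)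

@[simp]
lemma reflectPerm_true (n x y : ℤ) :
    reflectPerm n ((x, y), true) = ((n - 1 - x, y), true) := rfl

@[simp]
lemma reflectPerm_false (n x y : ℤ) :
    reflectPerm n ((x, y), false) = ((n - x, y), false) := rfl

/-- The translation by `t`, acting on bonds. -/
def translatePerm (t : ℤ × ℤ) : Equiv.Perm GridBond :=
  (Equiv.addRight t).prodCongr (Equiv.refl Bool)

lemma BondOpen.reflect {ω : PercCfg} {n : ℤ} {u v : ℤ × ℤ} (h : BondOpen ω u v) :
    BondOpen (relabel (reflectPerm n) false ω) (n - u.1, u.2) (n - v.1, v.2) := by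
  obtain ⟨u1, u2⟩ := u
  obtain ⟨v1, v2⟩ := v
  simp only [BondOpen, relabel, reflectPerm_true, reflectPerm_false, Prod.mk.injEq,
    Bool.false_xor] at *
  rcases h with ⟨⟨rfl, rfl⟩, h⟩ | ⟨⟨rfl, rfl⟩, h⟩ | ⟨⟨rfl, rfl⟩, h⟩ | ⟨⟨rfl, rfl⟩, h⟩
  · exact Or.inr (Or.inl ⟨⟨by ring, rfl⟩, by convert h using 4; ring⟩)
  · exact Or.inl ⟨⟨by ring, rfl⟩, by convert h using 4; ring⟩
  · exact Or.inr (Or.inr (Or.inl ⟨⟨rfl, rfl⟩, by simpa only [sub_sub_cancel] using h⟩))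
  · exact Or.inr (Or.inr (Or.inr ⟨⟨rfl, rfl⟩, by simpa only [sub_sub_cancel] using h⟩))

lemma BondOpen.of_translate {ω : PercCfg} {t u v : ℤ × ℤ}
    (h : BondOpen (relabel (translatePerm t) false ω) u v) : BondOpen ω (u + t) (v + t) := by
  obtain ⟨u1, u2⟩ := u
  obtain ⟨v1, v2⟩ := v
  obtain ⟨t1, t2⟩ := t
  simp only [BondOpen, relabel, translatePerm, Equiv.prodCongr_apply, Prod.map,
    Equiv.coe_addRight, Equiv.refl_apply, Prod.mk.injEq, Bool.false_xor, Prod.mk_add_mk] at *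
  rcases h with ⟨⟨rfl, rfl⟩, h⟩ | ⟨⟨rfl, rfl⟩, h⟩ | ⟨⟨rfl, rfl⟩, h⟩ | ⟨⟨rfl, rfl⟩, h⟩
  · exact Or.inl ⟨⟨by ring, rfl⟩, h⟩
  · exact Or.inr (Or.inl ⟨⟨by ring, rfl⟩, h⟩)
  · exact Or.inr (Or.inr (Or.inl ⟨⟨rfl, by ring⟩, h⟩))
  · exact Or.inr (Or.inr (Or.inr ⟨⟨rfl, by ring⟩, h⟩))

lemma reflect_mem_crossWith {ω : PercCfg} {n : ℕ} {p q : ℤ × ℤ → ℤ × ℤ → Prop}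
    (hpq : ∀ u v : ℤ × ℤ, p u v → q (n - u.1, u.2) (n - v.1, v.2)) (h : ω ∈ CrossWith n p) :
    relabel (reflectPerm n) false ω ∈ CrossWith n q := by
  obtain ⟨k, P, hP, h0, hk, hp⟩ := h
  refine ⟨k, fun i => (n - (P i).1, (P i).2), ⟨fun i hi => ?_, fun i hi => (hP.2 i hi).reflect⟩,
    h0, hk, hpq _ _ hp⟩
  have := hP.1 i hi
  unfold InRect at *
  simp only
  omega

/-- Diagonal crossings in opposite directions produce a near-vertical crossing. -/
lemma diagonals_subset {n : ℕ} (hn : 1 ≤ n) :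
    CrossWith n (fun u v => 3 * (n : ℤ) < 5 * (v.1 - u.1)) ∩
      CrossWith n (fun u v => 3 * (n : ℤ) < 5 * (u.1 - v.1)) ⊆
    CrossWith n (fun u v => 5 * |u.1 - v.1| ≤ 3 * (n : ℤ)) := by
  rintro ω ⟨⟨k, P, hP, hP0, hPk, hPd⟩, ⟨l, Q, hQ, hQ0, hQl, hQd⟩⟩
  have a1 := hP.1 0 (by omega)
  have a2 := hP.1 k le_rfl
  have a3 := hQ.1 0 (by omega)
  have a4 := hQ.1 l le_rfl
  simp only [InRect] at a1 a2 a3 a4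
  obtain ⟨i, hi, j, hj, hij⟩ := exists_common_vertex (by omega) hP hP0 hPk hQ hQ0 hQl
    (by omega) (by omega)
  obtain ⟨r, R, hR, hR0, hRr⟩ := exists_openPathIn (hP.1 0 (by omega))
    ((hP.reflTransGen (Nat.zero_le i) hi).trans
      (hij ▸ hQ.reflTransGen hj le_rfl))
  refine ⟨r, R, hR, by rw [hR0, hP0], by rw [hRr, hQl], ?_⟩
  rw [hR0, hRr]
  rcases abs_cases ((P 0).1 - (Q l).1) with h | h <;> omega

lemma measure_near_vertical {Pr : Measure PercCfg} (hPr : IsBondPerc Pr) {n : ℕ} (hn : 1 ≤ n) :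
    1 / 36 ≤ Pr (CrossWith n fun u v => 5 * |u.1 - v.1| ≤ 3 * (n : ℤ)) := by
  set E := CrossWith n fun u v => 5 * |u.1 - v.1| ≤ 3 * (n : ℤ) with hE
  set L := CrossWith n fun u v => 3 * (n : ℤ) < 5 * (v.1 - u.1) with hL
  set R := CrossWith n fun u v => 3 * (n : ℤ) < 5 * (u.1 - v.1) with hR
  have := hPr.1
  have hLR : Pr L = Pr R := by
    refine le_antisymm ?_ ?_
    · rw [← (increasingOn_crossWith n fun u v => 3 * (n : ℤ) < 5 * (u.1 - v.1)
        ).measure_preimage_relabel hPr (reflectPerm n) false]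
      exact measure_mono fun ω hω =>
        Set.mem_preimage.2 (reflect_mem_crossWith (fun u v h => by simp only; omega) hω)
    · rw [← (increasingOn_crossWith n fun u v => 3 * (n : ℤ) < 5 * (v.1 - u.1)
        ).measure_preimage_relabel hPr (reflectPerm n) false]
      exact measure_mono fun ω hω =>
        Set.mem_preimage.2 (reflect_mem_crossWith (fun u v h => by simp only; omega) hω)
  have hprod : Pr L * Pr R ≤ Pr E :=
    ((increasingOn_crossWith n _).mul_le_measure_inter (increasingOn_crossWith n _) hPr).trans
      (measure_mono (diagonals_subset hn))
  have hunion : Pr (CrossWith n fun _ _ => True) ≤ Pr E + Pr L + Pr R := by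
    refine (measure_mono ?_).trans ((measure_union_le (E ∪ L) R).trans
      (add_le_add_left (measure_union_le E L) _))
    rintro ω ⟨k, P, hP, h0, hk, -⟩
    by_cases h1 : 3 * (n : ℤ) < 5 * ((P k).1 - (P 0).1)
    · exact Or.inl (Or.inr ⟨k, P, hP, h0, hk, h1⟩)
    by_cases h2 : 3 * (n : ℤ) < 5 * ((P 0).1 - (P k).1)
    · exact Or.inr ⟨k, P, hP, h0, hk, h2⟩
    refine Or.inl (Or.inl ⟨k, P, hP, h0, hk, ?_⟩)
    rcases abs_cases ((P 0).1 - (P k).1) with h | h <;> omega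
  have hhalf := (one_le_two_mul_measure_crossWith hPr hn).trans (mul_le_mul_right hunion 2)
  rw [← hLR] at hprod hhalf
  lift Pr E to NNReal using measure_ne_top _ _ with e
  lift Pr L to NNReal using measure_ne_top _ _ with x
  have hprod' : (x : ℝ) * x ≤ e := by exact_mod_cast hprod
  have hhalf' : (1 : ℝ) ≤ 2 * (e + x + x) := by exact_mod_cast hhalf
  have key : (1 / 36 : ℝ) ≤ e := by
    by_contra! h
    nlinarith [x.2]
  have h36 : (1 / 36 : ENNReal) = ((1 / 36 : NNReal) : ENNReal) := by
    rw [ENNReal.coe_div (by norm_num)]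
    norm_num
  rw [h36, ENNReal.coe_le_coe, ← NNReal.coe_le_coe]
  push_cast
  exact key

/-- **Near-vertical crossings of squares** (Lemma 5.2): there is `c₂ > 0` such
that for every square `S = [a, a+n] × [b, b+n]`, the event `E(S)` that `S` has
an open vertical crossing whose endpoints `(x, b)` and `(x', b+n)` satisfy
`|x - x'| ≤ 3n/5` has probability at least `c₂`. -/
theorem near_vertical_crossing_Z2 :
    ∃ c2 : ENNReal, 0 < c2 ∧
      ∀ Pr : Measure PercCfg, IsBondPerc Pr →
        ∀ (n : ℕ), 1 ≤ n → ∀ a b : ℤ,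
          c2 ≤ Pr {ω | ∃ k Pth, OpenPathIn ω a (a + n) b (b + n) k Pth ∧
            (Pth 0).2 = b ∧ (Pth k).2 = b + n ∧
            5 * |(Pth 0).1 - (Pth k).1| ≤ 3 * (n : ℤ)} := by
  refine ⟨1 / 36, by simp, fun Pr hPr n hn a b => (measure_near_vertical hPr hn).trans ?_⟩
  rw [← (increasingOn_crossWith n _).measure_preimage_relabel hPr (translatePerm (a, b)) false]
  refine measure_mono ?_
  rintro ω ⟨k, P, hP, h0, hk, hd⟩
  refine ⟨k, fun i => P i + (a, b), ⟨fun i hi => ?_, fun i hi => (hP.2 i hi).of_translate⟩,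
    ?_, ?_, ?_⟩
  · have := hP.1 i hi
    simp only [InRect, Prod.fst_add, Prod.snd_add] at *
    omega
  · simp [h0]
  · simp [hk, add_comm]
  · simpa using hd
end
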